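/- Let u be a classical solution with decay weight b of the Zakharov–Kuznetsov–Burgers problem on the strip S. Then for every t > 0: (d/dt)(e^{2bx}, u²)(t) + (2 + 6b)(e^{2bx}, u_x²)(t) + 2b(e^{2bx}, u_y²)(t) − (4b/3)(e^{2bx}, u³)(t) − (4b² + 8b³)(e^{2bx}, u²)(t) = 0. -/

import Mathlib

open MeasureTheory Real Set

/-- The mixed partial derivative `∂_x^i ∂_y^j ∂_t^k u` of a function
`u = u(x, y, t)`, evaluated at `(x, y, t)`. -/
noncomputable def pd (i j k : ℕ) (u : ℝ → ℝ → ℝ → ℝ) (x y t : ℝ) : ℝ :=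
  iteratedDeriv i (fun x' => iteratedDeriv j (fun y' => iteratedDeriv k (u x' y') t) y) x

/-- The strip `S = ℝ × (0, B)`. -/
def strip (B : ℝ) : Set (ℝ × ℝ) := Set.univ ×ˢ Set.Ioo 0 B

/-- A classical solution, with decay weight `b`, of the Zakharov–Kuznetsov–Burgers
initial-boundary value problem on the strip `S = ℝ × (0, B)`:
a smooth function `u(x, y, t)` satisfying the ZKB equation
`u_t - u_xx + u u_x + u_xxx + u_xyy = 0` in `ℝ × (0,B) × (0,∞)`, the Dirichlet
boundary conditions `u(x,0,t) = u(x,B,t) = 0`, and such that for every partial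
derivative `∂^α u` of order `|α| ≤ 5` in `x, y, t`, both `|∂^α u|²` and
`e^{2bx} |∂^α u|²` are integrable over `S` for each `t ≥ 0`, with integrals
bounded uniformly for `t` in compact subsets of `[0, ∞)`, and
`(1 + e^{2bx}) |∂^α u(x,y,t)|² → 0` as `|x| → ∞`, uniformly in `y` and locally
uniformly in `t`. -/
structure IsZKBSolution (B b : ℝ) (u : ℝ → ℝ → ℝ → ℝ) : Prop where
  smooth : ContDiff ℝ (⊤ : ℕ∞) (fun p : ℝ × ℝ × ℝ => u p.1 p.2.1 p.2.2)
  pde : ∀ x : ℝ, ∀ y ∈ Set.Ioo (0:ℝ) B, ∀ t : ℝ, 0 < t →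
    pd 0 0 1 u x y t - pd 2 0 0 u x y t + u x y t * pd 1 0 0 u x y t
      + pd 3 0 0 u x y t + pd 1 2 0 u x y t = 0
  bdry0 : ∀ x t : ℝ, 0 ≤ t → u x 0 t = 0
  bdryB : ∀ x t : ℝ, 0 ≤ t → u x B t = 0
  integ : ∀ i j k : ℕ, i + j + k ≤ 5 → ∀ t : ℝ, 0 ≤ t →
    IntegrableOn (fun p : ℝ × ℝ => (1 + Real.exp (2*b*p.1)) * (pd i j k u p.1 p.2 t)^2)
      (strip B) volume
  bdd : ∀ i j k : ℕ, i + j + k ≤ 5 → ∀ T : ℝ, ∃ M : ℝ, ∀ t ∈ Set.Icc (0:ℝ) T,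
    (∫ p in strip B, (1 + Real.exp (2*b*p.1)) * (pd i j k u p.1 p.2 t)^2) ≤ M
  decay : ∀ i j k : ℕ, i + j + k ≤ 5 → ∀ T : ℝ, ∀ ε : ℝ, 0 < ε → ∃ R : ℝ,
    ∀ x : ℝ, R ≤ |x| → ∀ y ∈ Set.Icc (0:ℝ) B, ∀ t ∈ Set.Icc (0:ℝ) T,
      (1 + Real.exp (2*b*x)) * (pd i j k u x y t)^2 ≤ ε

open scoped ContDiff Topology

section DirectionalDerivative

variable {E : Type*} [NormedAddCommGroup E] [NormedSpace ℝ E]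

/-- The derivative of a smooth function in the direction `v`, as an operator on smooth functions. -/
noncomputable def dirDeriv (v : E) (F : {F : E → ℝ // ContDiff ℝ ∞ F}) :
    {F : E → ℝ // ContDiff ℝ ∞ F} :=
  ⟨fun p => fderiv ℝ F.1 p v, (F.2.fderiv_right (by simp)).clm_apply contDiff_const⟩

theorem dirDeriv_commute (v w : E) : Function.Commute (dirDeriv v) (dirDeriv w) := by
  intro F
  apply Subtype.ext
  funext p
  have hd : DifferentiableAt ℝ (fderiv ℝ F.1) p :=
    (F.2.fderiv_right (m := ∞) (by simp)).differentiable (by simp) p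
  have hs := (F.2.contDiffAt (x := p)).isSymmSndFDerivAt
    (by rw [minSmoothness_of_isRCLikeNormedField]; exact WithTop.coe_le_coe.2 le_top)
  change fderiv ℝ (fun q => fderiv ℝ F.1 q w) p v = fderiv ℝ (fun q => fderiv ℝ F.1 q v) p w
  rw [fderiv_clm_apply hd (differentiableAt_const _),
    fderiv_clm_apply hd (differentiableAt_const _)]
  simpa using hs.eq v w

theorem hasDerivAt_dirDeriv_comp {γ : ℝ → E} {v : E} (hγ : ∀ s, HasDerivAt γ v s)
    (F : {F : E → ℝ // ContDiff ℝ ∞ F}) (s : ℝ) :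
    HasDerivAt (fun s => F.1 (γ s)) ((dirDeriv v F).1 (γ s)) s :=
  ((F.2.differentiable (by simp) (γ s)).hasFDerivAt).comp_hasDerivAt s (hγ s)

theorem iteratedDeriv_comp_eq_dirDeriv {γ : ℝ → E} {v : E} (hγ : ∀ s, HasDerivAt γ v s) (n : ℕ)
    (F : {F : E → ℝ // ContDiff ℝ ∞ F}) :
    iteratedDeriv n (fun s => F.1 (γ s)) = fun s => ((dirDeriv v)^[n] F).1 (γ s) := by
  induction n with
  | zero => simp
  | succ n ih =>
    funext s
    rw [iteratedDeriv_succ, ih, Function.iterate_succ_apply']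
    exact (hasDerivAt_dirDeriv_comp hγ _ s).deriv

end DirectionalDerivative

section PartialDerivative

variable {u : ℝ → ℝ → ℝ → ℝ}

theorem hasDerivAt_line_fst (y t s : ℝ) :
    HasDerivAt (fun x : ℝ => (x, y, t)) ((1, 0, 0) : ℝ × ℝ × ℝ) s :=
  (hasDerivAt_id s).prodMk ((hasDerivAt_const s y).prodMk (hasDerivAt_const s t))

theorem hasDerivAt_line_snd (x t s : ℝ) :
    HasDerivAt (fun y : ℝ => (x, y, t)) ((0, 1, 0) : ℝ × ℝ × ℝ) s :=
  (hasDerivAt_const s x).prodMk ((hasDerivAt_id s).prodMk (hasDerivAt_const s t))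

theorem hasDerivAt_line_trd (x y s : ℝ) :
    HasDerivAt (fun t : ℝ => (x, y, t)) ((0, 0, 1) : ℝ × ℝ × ℝ) s :=
  (hasDerivAt_const s x).prodMk ((hasDerivAt_const s y).prodMk (hasDerivAt_id s))

theorem pd_eq_dirDeriv (hu : ContDiff ℝ ∞ (fun p : ℝ × ℝ × ℝ => u p.1 p.2.1 p.2.2))
    (i j k : ℕ) (x y t : ℝ) :
    pd i j k u x y t = ((dirDeriv ((1, 0, 0) : ℝ × ℝ × ℝ))^[i] ((dirDeriv (0, 1, 0))^[j]
      ((dirDeriv (0, 0, 1))^[k] ⟨_, hu⟩))).1 (x, y, t) := by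
  have ht : ∀ x' y', iteratedDeriv k (u x' y') t =
      ((dirDeriv ((0, 0, 1) : ℝ × ℝ × ℝ))^[k] ⟨_, hu⟩).1 (x', y', t) := fun x' y' =>
    congrFun (iteratedDeriv_comp_eq_dirDeriv (hasDerivAt_line_trd x' y') k ⟨_, hu⟩) t
  simp only [pd, ht, iteratedDeriv_comp_eq_dirDeriv (hasDerivAt_line_snd _ t),
    iteratedDeriv_comp_eq_dirDeriv (hasDerivAt_line_fst y t)]

theorem continuous_pd (hu : ContDiff ℝ ∞ (fun p : ℝ × ℝ × ℝ => u p.1 p.2.1 p.2.2))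
    (i j k : ℕ) : Continuous (fun p : ℝ × ℝ × ℝ => pd i j k u p.1 p.2.1 p.2.2) := by
  simp only [pd_eq_dirDeriv hu]
  exact Subtype.property (p := ContDiff ℝ ∞) _ |>.continuous

theorem hasDerivAt_pd_fst (hu : ContDiff ℝ ∞ (fun p : ℝ × ℝ × ℝ => u p.1 p.2.1 p.2.2))
    (i j k : ℕ) (x y t : ℝ) :
    HasDerivAt (fun x => pd i j k u x y t) (pd (i + 1) j k u x y t) x := by
  simp only [pd_eq_dirDeriv hu, Function.iterate_succ_apply']
  exact hasDerivAt_dirDeriv_comp (hasDerivAt_line_fst y t) _ x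

theorem hasDerivAt_pd_snd (hu : ContDiff ℝ ∞ (fun p : ℝ × ℝ × ℝ => u p.1 p.2.1 p.2.2))
    (i j k : ℕ) (x y t : ℝ) :
    HasDerivAt (fun y => pd i j k u x y t) (pd i (j + 1) k u x y t) y := by
  simp only [pd_eq_dirDeriv hu, Function.iterate_succ_apply']
  rw [((dirDeriv_commute _ _).iterate_left i).eq]
  exact hasDerivAt_dirDeriv_comp (hasDerivAt_line_snd x t) _ y

theorem hasDerivAt_pd_trd (hu : ContDiff ℝ ∞ (fun p : ℝ × ℝ × ℝ => u p.1 p.2.1 p.2.2))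
    (i j k : ℕ) (x y t : ℝ) :
    HasDerivAt (fun t => pd i j k u x y t) (pd i j (k + 1) u x y t) t := by
  simp only [pd_eq_dirDeriv hu, Function.iterate_succ_apply']
  rw [((dirDeriv_commute _ _).iterate_left j).eq, ((dirDeriv_commute _ _).iterate_left i).eq]
  exact hasDerivAt_dirDeriv_comp (hasDerivAt_line_trd x y) _ t

theorem pd_zero (x y t : ℝ) : pd 0 0 0 u x y t = u x y t := by simp [pd]

end PartialDerivative

section DerivativeOfIntegral

variable {α : Type*} [TopologicalSpace α] [MeasurableSpace α] [OpensMeasurableSpace α]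
  [SecondCountableTopology α] {μ : Measure α} [SFinite μ]

/-- The fundamental theorem of calculus under the integral sign, when the time derivative is
bounded in `L¹(μ)` uniformly in time. -/
theorem integral_sub_integral_eq_intervalIntegral {g g' : ℝ → α → ℝ} {T M : ℝ}
    (hd : ∀ s p, HasDerivAt (fun s => g s p) (g' s p) s)
    (hc : Continuous (Function.uncurry g'))
    (hi : ∀ s ∈ Icc 0 T, Integrable (g s) μ) (hi' : ∀ s ∈ Icc 0 T, Integrable (g' s) μ)
    (hM : ∀ s ∈ Icc 0 T, ∫ p, ‖g' s p‖ ∂μ ≤ M) {a c : ℝ} (ha : a ∈ Icc 0 T) (hc' : c ∈ Icc 0 T) :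
    ∫ p, g c p ∂μ - ∫ p, g a p ∂μ = ∫ s in a..c, ∫ p, g' s p ∂μ := by
  have hsub : uIoc a c ⊆ Icc 0 T :=
    uIoc_subset_uIcc.trans (ordConnected_Icc.uIcc_subset ha hc')
  have hmeas : AEStronglyMeasurable (Function.uncurry g')
      ((volume.restrict (uIoc a c)).prod μ) := hc.measurable.aestronglyMeasurable
  have hint : Integrable (Function.uncurry g') ((volume.restrict (uIoc a c)).prod μ) := by
    rw [integrable_prod_iff hmeas]
    refine ⟨?_, ?_⟩
    · exact (ae_restrict_iff' measurableSet_uIoc).2 (.of_forall fun s hs => hi' s (hsub hs))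
    · have : IntegrableOn (fun _ : ℝ => M) (uIoc a c) := by
        simp [uIoc]
      refine this.mono' hmeas.norm.integral_prod_right' ?_
      refine (ae_restrict_iff' measurableSet_uIoc).2 (.of_forall fun s hs => ?_)
      rw [Real.norm_of_nonneg (integral_nonneg fun _ => norm_nonneg _)]
      exact hM s (hsub hs)
  rw [intervalIntegral_integral_swap hint, ← integral_sub (hi c hc') (hi a ha)]
  refine integral_congr_ae (.of_forall fun p => ?_)
  refine (intervalIntegral.integral_eq_sub_of_hasDerivAt (fun s _ => hd s p) ?_).symm
  exact (hc.comp (by fun_prop : Continuous fun s : ℝ => (s, p))).intervalIntegrable _ _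

theorem hasDerivAt_integral_of_bounded_snd_deriv {g g' g'' : ℝ → α → ℝ} {T M M' : ℝ}
    (hd : ∀ s p, HasDerivAt (fun s => g s p) (g' s p) s)
    (hd' : ∀ s p, HasDerivAt (fun s => g' s p) (g'' s p) s)
    (hc : Continuous (Function.uncurry g')) (hc' : Continuous (Function.uncurry g''))
    (hi : ∀ s ∈ Icc 0 T, Integrable (g s) μ) (hi' : ∀ s ∈ Icc 0 T, Integrable (g' s) μ)
    (hi'' : ∀ s ∈ Icc 0 T, Integrable (g'' s) μ)
    (hM : ∀ s ∈ Icc 0 T, ∫ p, ‖g' s p‖ ∂μ ≤ M) (hM' : ∀ s ∈ Icc 0 T, ∫ p, ‖g'' s p‖ ∂μ ≤ M')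
    {t : ℝ} (ht : t ∈ Ioo 0 T) :
    HasDerivAt (fun s => ∫ p, g s p ∂μ) (∫ p, g' t p ∂μ) t := by
  have htI : t ∈ Icc 0 T := Ioo_subset_Icc_self ht
  have hcont : ContinuousOn (fun s => ∫ p, g' s p ∂μ) (Icc 0 T) := by
    refine (LipschitzOnWith.of_dist_le_mul (K := M'.toNNReal) fun c hc₁ a ha => ?_).continuousOn
    rw [Real.dist_eq, Real.dist_eq,
      integral_sub_integral_eq_intervalIntegral hd' hc' hi' hi'' hM' ha hc₁, ← Real.norm_eq_abs]
    refine intervalIntegral.norm_integral_le_of_norm_le_const fun s hs => ?_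
    have hs' : s ∈ Icc 0 T :=
      (uIoc_subset_uIcc.trans (ordConnected_Icc.uIcc_subset ha hc₁)) hs
    exact (norm_integral_le_integral_norm _).trans ((hM' s hs').trans (Real.le_coe_toNNReal _))
  have hF : HasDerivAt (fun r => ∫ s in t..r, ∫ p, g' s p ∂μ) (∫ p, g' t p ∂μ) t := by
    refine intervalIntegral.integral_hasDerivAt_right (by simp) ?_
      (hcont.continuousAt (Icc_mem_nhds ht.1 ht.2))
    exact (hcont.mono Ioo_subset_Icc_self).stronglyMeasurableAtFilter isOpen_Ioo t ht
  refine (hF.add_const (∫ p, g t p ∂μ)).congr_of_eventuallyEq ?_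
  filter_upwards [Icc_mem_nhds ht.1 ht.2] with r hr
  rw [← integral_sub_integral_eq_intervalIntegral hd hc hi hi' hM htI hr]
  ring

end DerivativeOfIntegral

section Strip

variable {B : ℝ}

theorem volume_restrict_strip :
    (volume : Measure (ℝ × ℝ)).restrict (strip B) =
      (volume : Measure ℝ).prod ((volume : Measure ℝ).restrict (Ioo 0 B)) := by
  rw [strip, Measure.volume_eq_prod, ← Measure.prod_restrict, Measure.restrict_univ]

theorem measurableSet_strip : MeasurableSet (strip B) := MeasurableSet.univ.prod measurableSet_Ioo

/-- The integral over the strip of an `x`-derivative vanishes. -/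
theorem integral_strip_deriv_fst {P P' : ℝ × ℝ → ℝ}
    (hd : ∀ x y, HasDerivAt (fun x => P (x, y)) (P' (x, y)) x)
    (hP : IntegrableOn P (strip B)) (hP' : IntegrableOn P' (strip B)) :
    ∫ p in strip B, P' p = 0 := by
  rw [IntegrableOn, volume_restrict_strip] at hP hP'
  rw [volume_restrict_strip, integral_prod_symm _ hP']
  refine integral_eq_zero_of_ae ?_
  filter_upwards [hP.prod_left_ae, hP'.prod_left_ae] with y hy hy'
  exact integral_eq_zero_of_hasDerivAt_of_integrable (fun x => hd x y) hy' hy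

/-- The integral over the strip of the `y`-derivative of a function vanishing on the boundary
vanishes. -/
theorem integral_strip_deriv_snd {Q Q' : ℝ × ℝ → ℝ} (hB : 0 ≤ B)
    (hd : ∀ x y, HasDerivAt (fun y => Q (x, y)) (Q' (x, y)) y) (hc : Continuous Q')
    (hQ' : IntegrableOn Q' (strip B)) (h0 : ∀ x, Q (x, 0) = 0) (h1 : ∀ x, Q (x, B) = 0) :
    ∫ p in strip B, Q' p = 0 := by
  rw [IntegrableOn, volume_restrict_strip] at hQ'
  rw [volume_restrict_strip, integral_prod _ hQ']
  refine integral_eq_zero_of_ae (.of_forall fun x => ?_)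
  change ∫ y in Ioo 0 B, Q' (x, y) = 0
  rw [← integral_Ioc_eq_integral_Ioo, ← intervalIntegral.integral_of_le hB,
    intervalIntegral.integral_eq_sub_of_hasDerivAt (fun y _ => hd x y)
      ((hc.comp (by fun_prop : Continuous fun y : ℝ => (x, y))).intervalIntegrable _ _), h0, h1]
  simp

end Strip

namespace IsZKBSolution

variable {B b : ℝ} {u : ℝ → ℝ → ℝ → ℝ}

theorem continuous_pd_slice (hu : IsZKBSolution B b u) (i j k : ℕ) (t : ℝ) :
    Continuous (fun p : ℝ × ℝ => pd i j k u p.1 p.2 t) :=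
  (continuous_pd hu.smooth i j k).comp
    (by fun_prop : Continuous fun p : ℝ × ℝ => (p.1, p.2, t))

theorem abs_weight_mul_mul_le (w p q : ℝ) (hw : 0 ≤ w) :
    |w * (p * q)| ≤ (1 + w) * p ^ 2 + (1 + w) * q ^ 2 := by
  have h : |p * q| ≤ p ^ 2 + q ^ 2 := by
    rw [abs_le]
    constructor <;> nlinarith [sq_nonneg (p + q), sq_nonneg (p - q), sq_nonneg p, sq_nonneg q]
  rw [abs_mul, abs_of_nonneg hw]
  nlinarith [mul_le_mul_of_nonneg_left h hw, sq_nonneg p, sq_nonneg q]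

theorem integrableOn_mul (hu : IsZKBSolution B b u) {i j k i' j' k' : ℕ}
    (h : i + j + k ≤ 5) (h' : i' + j' + k' ≤ 5) {t : ℝ} (ht : 0 ≤ t) :
    IntegrableOn (fun p : ℝ × ℝ => Real.exp (2 * b * p.1) *
      (pd i j k u p.1 p.2 t * pd i' j' k' u p.1 p.2 t)) (strip B) := by
  refine ((hu.integ i j k h t ht).add (hu.integ i' j' k' h' t ht)).mono' ?_
    (.of_forall fun p => abs_weight_mul_mul_le _ _ _ (Real.exp_pos _).le)
  have := hu.continuous_pd_slice i j k t
  have := hu.continuous_pd_slice i' j' k' t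
  exact Continuous.aestronglyMeasurable (by fun_prop)

theorem exists_integral_norm_mul_le (hu : IsZKBSolution B b u) {i j k i' j' k' : ℕ}
    (h : i + j + k ≤ 5) (h' : i' + j' + k' ≤ 5) (T : ℝ) :
    ∃ M, ∀ t ∈ Icc 0 T, ∫ p in strip B, ‖Real.exp (2 * b * p.1) *
      (pd i j k u p.1 p.2 t * pd i' j' k' u p.1 p.2 t)‖ ≤ M := by
  obtain ⟨M, hM⟩ := hu.bdd i j k h T
  obtain ⟨M', hM'⟩ := hu.bdd i' j' k' h' T
  refine ⟨M + M', fun t ht => ?_⟩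
  refine le_trans ?_ (add_le_add (hM t ht) (hM' t ht))
  have h₁ := hu.integ i j k h t ht.1
  have h₂ := hu.integ i' j' k' h' t ht.1
  rw [← integral_add h₁ h₂]
  exact integral_mono (hu.integrableOn_mul h h' ht.1).norm (h₁.add h₂)
    fun p => abs_weight_mul_mul_le _ _ _ (Real.exp_pos _).le

/-- A classical solution is bounded on the strip at each time. -/
theorem exists_abs_le (hu : IsZKBSolution B b u) {t : ℝ} (ht : 0 ≤ t) :
    ∃ C, ∀ p ∈ strip B, |pd 0 0 0 u p.1 p.2 t| ≤ C := by
  obtain ⟨R, hR⟩ := hu.decay 0 0 0 (by norm_num) t 1 one_pos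
  obtain ⟨C, hC⟩ := (isCompact_Icc.prod isCompact_Icc :
    IsCompact (Icc (-R) R ×ˢ Icc 0 B)).exists_bound_of_continuousOn
      (hu.continuous_pd_slice 0 0 0 t).continuousOn
  refine ⟨max C 1, fun p hp => ?_⟩
  have hy : p.2 ∈ Icc 0 B := Ioo_subset_Icc_self hp.2
  rcases le_total R |p.1| with h | h
  · refine le_max_of_le_right ((sq_le_one_iff_abs_le_one _).1 ?_)
    have h₁ := hR p.1 h p.2 hy t ⟨ht, le_rfl⟩
    nlinarith [mul_nonneg (Real.exp_pos (2 * b * p.1)).le (sq_nonneg (pd 0 0 0 u p.1 p.2 t))]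
  · exact le_max_of_le_left (hC p ⟨abs_le.1 h, hy⟩)

theorem integrableOn_mul_mul (hu : IsZKBSolution B b u) {i j k i' j' k' : ℕ}
    (h : i + j + k ≤ 5) (h' : i' + j' + k' ≤ 5) {t : ℝ} (ht : 0 ≤ t) :
    IntegrableOn (fun p : ℝ × ℝ => pd 0 0 0 u p.1 p.2 t * (Real.exp (2 * b * p.1) *
      (pd i j k u p.1 p.2 t * pd i' j' k' u p.1 p.2 t))) (strip B) := by
  obtain ⟨C, hC⟩ := hu.exists_abs_le ht
  exact Integrable.bdd_mul (hu.integrableOn_mul h h' ht)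
    (hu.continuous_pd_slice 0 0 0 t).aestronglyMeasurable
    ((ae_restrict_iff' measurableSet_strip).2 (.of_forall hC))

theorem hasDerivAt_integral_sq (hu : IsZKBSolution B b u) {t : ℝ} (ht : 0 < t) :
    HasDerivAt (fun τ => ∫ p in strip B, Real.exp (2 * b * p.1) * (u p.1 p.2 τ) ^ 2)
      (∫ p in strip B, 2 * (Real.exp (2 * b * p.1) *
        (pd 0 0 0 u p.1 p.2 t * pd 0 0 1 u p.1 p.2 t))) t := by
  have hdt (k : ℕ) (s : ℝ) (p : ℝ × ℝ) := hasDerivAt_pd_trd hu.smooth 0 0 k p.1 p.2 s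
  have hc (k : ℕ) : Continuous fun q : ℝ × ℝ × ℝ => pd 0 0 k u q.2.1 q.2.2 q.1 :=
    (continuous_pd hu.smooth 0 0 k).comp
      (by fun_prop : Continuous fun q : ℝ × ℝ × ℝ => (q.2.1, q.2.2, q.1))
  have hc₀ := hc 0
  have hc₁ := hc 1
  have hc₂ := hc 2
  obtain ⟨M, hM⟩ := hu.exists_integral_norm_mul_le (i := 0) (j := 0) (k := 0) (i' := 0) (j' := 0)
    (k' := 1) (by norm_num) (by norm_num) (t + 1)
  obtain ⟨N₁, hN₁⟩ := hu.exists_integral_norm_mul_le (i := 0) (j := 0) (k := 1) (i' := 0)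
    (j' := 0) (k' := 1) (by norm_num) (by norm_num) (t + 1)
  obtain ⟨N₂, hN₂⟩ := hu.exists_integral_norm_mul_le (i := 0) (j := 0) (k := 0) (i' := 0)
    (j' := 0) (k' := 2) (by norm_num) (by norm_num) (t + 1)
  have hi (k k' : ℕ) (hk : k ≤ 2) (hk' : k' ≤ 2) (s : ℝ) (hs : s ∈ Icc 0 (t + 1)) :=
    hu.integrableOn_mul (i := 0) (j := 0) (k := k) (i' := 0) (j' := 0) (k' := k') (by omega)
      (by omega) hs.1
  have key := hasDerivAt_integral_of_bounded_snd_deriv (μ := volume.restrict (strip B))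
    (g := fun s p => Real.exp (2 * b * p.1) * (pd 0 0 0 u p.1 p.2 s * pd 0 0 0 u p.1 p.2 s))
    (g' := fun s p => 2 * (Real.exp (2 * b * p.1) *
      (pd 0 0 0 u p.1 p.2 s * pd 0 0 1 u p.1 p.2 s)))
    (g'' := fun s p => 2 * (Real.exp (2 * b * p.1) *
      (pd 0 0 1 u p.1 p.2 s * pd 0 0 1 u p.1 p.2 s) + Real.exp (2 * b * p.1) *
      (pd 0 0 0 u p.1 p.2 s * pd 0 0 2 u p.1 p.2 s)))
    (T := t + 1) (M := 2 * M) (M' := 2 * (N₁ + N₂)) (t := t) ?_ ?_ ?_ ?_ ?_ ?_ ?_ ?_ ?_ ?_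
  · simpa only [pd_zero, ← sq] using key
  · intro s p
    exact (((hdt 0 s p).mul (hdt 0 s p)).const_mul _).congr_deriv (by ring)
  · intro s p
    exact ((((hdt 0 s p).mul (hdt 1 s p)).const_mul _).const_mul 2).congr_deriv (by ring)
  · unfold Function.uncurry
    fun_prop
  · unfold Function.uncurry
    fun_prop
  · exact hi 0 0 (by norm_num) (by norm_num)
  · exact fun s hs => (hi 0 1 (by norm_num) (by norm_num) s hs).const_mul 2
  · exact fun s hs => ((hi 1 1 (by norm_num) (by norm_num) s hs).add
      (hi 0 2 (by norm_num) (by norm_num) s hs)).const_mul 2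
  · intro s hs
    simp only [norm_mul (2 : ℝ), Real.norm_ofNat]
    rw [integral_const_mul]
    exact mul_le_mul_of_nonneg_left (hM s hs) two_pos.le
  · intro s hs
    have h₁ := hi 1 1 (by norm_num) (by norm_num) s hs
    have h₂ := hi 0 2 (by norm_num) (by norm_num) s hs
    simp only [norm_mul (2 : ℝ), Real.norm_ofNat]
    rw [integral_const_mul]
    refine mul_le_mul_of_nonneg_left ?_ two_pos.le
    refine le_trans ?_ (add_le_add (hN₁ s hs) (hN₂ s hs))
    rw [← integral_add h₁.norm h₂.norm]
    exact integral_mono (h₁.add h₂).norm (h₁.norm.add h₂.norm) fun p => norm_add_le _ _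
  · exact ⟨ht, by linarith⟩

/-- The `x`-flux in the local form of the weighted energy balance. -/
noncomputable def fluxX (b : ℝ) (u : ℝ → ℝ → ℝ → ℝ) (t : ℝ) (p : ℝ × ℝ) : ℝ :=
  Real.exp (2 * b * p.1) *
    ((2 + 4 * b) * (pd 0 0 0 u p.1 p.2 t * pd 1 0 0 u p.1 p.2 t)
      - (2 * b + 4 * b ^ 2) * (pd 0 0 0 u p.1 p.2 t * pd 0 0 0 u p.1 p.2 t)
      - 2 / 3 * (pd 0 0 0 u p.1 p.2 t * (pd 0 0 0 u p.1 p.2 t * pd 0 0 0 u p.1 p.2 t))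
      - 2 * (pd 0 0 0 u p.1 p.2 t * pd 2 0 0 u p.1 p.2 t)
      + pd 1 0 0 u p.1 p.2 t * pd 1 0 0 u p.1 p.2 t
      + pd 0 1 0 u p.1 p.2 t * pd 0 1 0 u p.1 p.2 t)

/-- The `x`-derivative of `fluxX`. -/
noncomputable def fluxXDeriv (b : ℝ) (u : ℝ → ℝ → ℝ → ℝ) (t : ℝ) (p : ℝ × ℝ) : ℝ :=
  2 * b * fluxX b u t p + Real.exp (2 * b * p.1) *
    ((2 + 4 * b) * (pd 1 0 0 u p.1 p.2 t * pd 1 0 0 u p.1 p.2 t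
        + pd 0 0 0 u p.1 p.2 t * pd 2 0 0 u p.1 p.2 t)
      - (4 * b + 8 * b ^ 2) * (pd 0 0 0 u p.1 p.2 t * pd 1 0 0 u p.1 p.2 t)
      - 2 * (pd 0 0 0 u p.1 p.2 t * (pd 0 0 0 u p.1 p.2 t * pd 1 0 0 u p.1 p.2 t))
      - 2 * (pd 0 0 0 u p.1 p.2 t * pd 3 0 0 u p.1 p.2 t)
      + 2 * (pd 0 1 0 u p.1 p.2 t * pd 1 1 0 u p.1 p.2 t))

theorem hasDerivAt_exp_weight (b x : ℝ) :
    HasDerivAt (fun x => Real.exp (2 * b * x)) (2 * b * Real.exp (2 * b * x)) x :=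
  (((hasDerivAt_id x).const_mul (2 * b)).exp).congr_deriv (by simp; ring)

theorem hasDerivAt_fluxX (hu : IsZKBSolution B b u) (t x y : ℝ) :
    HasDerivAt (fun x => fluxX b u t (x, y)) (fluxXDeriv b u t (x, y)) x := by
  have h0 := hasDerivAt_pd_fst hu.smooth 0 0 0 x y t
  have h1 := hasDerivAt_pd_fst hu.smooth 1 0 0 x y t
  have h2 := hasDerivAt_pd_fst hu.smooth 2 0 0 x y t
  have hy := hasDerivAt_pd_fst hu.smooth 0 1 0 x y t
  refine ((hasDerivAt_exp_weight b x).mul ((((((h0.mul h1).const_mul (2 + 4 * b)).sub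
    ((h0.mul h0).const_mul (2 * b + 4 * b ^ 2))).sub
    ((h0.mul (h0.mul h0)).const_mul (2 / 3))).sub ((h0.mul h2).const_mul 2)).add
    (h1.mul h1) |>.add (hy.mul hy))).congr_deriv ?_
  simp only [fluxXDeriv, fluxX, Pi.mul_apply, Pi.add_apply, Pi.sub_apply]
  ring

theorem integrableOn_fluxX (hu : IsZKBSolution B b u) {t : ℝ} (ht : 0 ≤ t) :
    IntegrableOn (fluxX b u t) (strip B) := by
  have I (i j i' j' : ℕ) (h : i + j + 0 ≤ 5) (h' : i' + j' + 0 ≤ 5) :=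
    hu.integrableOn_mul h h' ht
  have J := hu.integrableOn_mul_mul (i := 0) (j := 0) (k := 0) (i' := 0) (j' := 0) (k' := 0)
    (by norm_num) (by norm_num) ht
  refine (((((((I 0 0 1 0 (by norm_num) (by norm_num)).const_mul (2 + 4 * b)).sub
    ((I 0 0 0 0 (by norm_num) (by norm_num)).const_mul (2 * b + 4 * b ^ 2))).sub
    (J.const_mul (2 / 3))).sub ((I 0 0 2 0 (by norm_num) (by norm_num)).const_mul 2)).add
    (I 1 0 1 0 (by norm_num) (by norm_num))).add
    (I 0 1 0 1 (by norm_num) (by norm_num))).congr (.of_forall fun p => ?_)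
  simp only [fluxX, Pi.add_apply, Pi.sub_apply]
  ring

theorem integrableOn_fluxXDeriv (hu : IsZKBSolution B b u) {t : ℝ} (ht : 0 ≤ t) :
    IntegrableOn (fluxXDeriv b u t) (strip B) := by
  have I (i j i' j' : ℕ) (h : i + j + 0 ≤ 5) (h' : i' + j' + 0 ≤ 5) :=
    hu.integrableOn_mul h h' ht
  have J := hu.integrableOn_mul_mul (i := 0) (j := 0) (k := 0) (i' := 1) (j' := 0) (k' := 0)
    (by norm_num) (by norm_num) ht
  refine (((hu.integrableOn_fluxX ht).const_mul (2 * b)).add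
    ((((((I 1 0 1 0 (by norm_num) (by norm_num)).add
      (I 0 0 2 0 (by norm_num) (by norm_num))).const_mul (2 + 4 * b)).sub
    ((I 0 0 1 0 (by norm_num) (by norm_num)).const_mul (4 * b + 8 * b ^ 2))).sub
    (J.const_mul 2)).sub ((I 0 0 3 0 (by norm_num) (by norm_num)).const_mul 2) |>.add
    ((I 0 1 1 1 (by norm_num) (by norm_num)).const_mul 2))).congr (.of_forall fun p => ?_)
  simp only [fluxXDeriv, Pi.add_apply, Pi.sub_apply]
  ring

/-- The `y`-derivative of the `y`-flux `-2 e^{2bx} u u_xy` of the weighted energy balance. -/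
noncomputable def fluxYDeriv (b : ℝ) (u : ℝ → ℝ → ℝ → ℝ) (t : ℝ) (p : ℝ × ℝ) : ℝ :=
  -2 * (Real.exp (2 * b * p.1) * (pd 0 1 0 u p.1 p.2 t * pd 1 1 0 u p.1 p.2 t)
    + Real.exp (2 * b * p.1) * (pd 0 0 0 u p.1 p.2 t * pd 1 2 0 u p.1 p.2 t))

theorem integrableOn_fluxYDeriv (hu : IsZKBSolution B b u) {t : ℝ} (ht : 0 ≤ t) :
    IntegrableOn (fluxYDeriv b u t) (strip B) :=
  ((hu.integrableOn_mul (by norm_num) (by norm_num) ht).add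
    (hu.integrableOn_mul (by norm_num) (by norm_num) ht)).const_mul (-2)

theorem integral_fluxYDeriv (hu : IsZKBSolution B b u) (hB : 0 ≤ B) {t : ℝ} (ht : 0 ≤ t) :
    ∫ p in strip B, fluxYDeriv b u t p = 0 := by
  refine integral_strip_deriv_snd (Q := fun p => -2 * (Real.exp (2 * b * p.1) *
    (pd 0 0 0 u p.1 p.2 t * pd 1 1 0 u p.1 p.2 t))) hB (fun x y => ?_) ?_
    (hu.integrableOn_fluxYDeriv ht) (fun x => ?_) (fun x => ?_)
  · refine ((((hasDerivAt_pd_snd hu.smooth 0 0 0 x y t).mul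
      (hasDerivAt_pd_snd hu.smooth 1 1 0 x y t)).const_mul (Real.exp (2 * b * x))).const_mul
      (-2)).congr_deriv ?_
    simp only [fluxYDeriv]
    ring
  · have := hu.continuous_pd_slice 0 0 0 t
    have := hu.continuous_pd_slice 0 1 0 t
    have := hu.continuous_pd_slice 1 1 0 t
    have := hu.continuous_pd_slice 1 2 0 t
    unfold fluxYDeriv
    fun_prop
  · simp [pd_zero, hu.bdry0 x t ht]
  · simp [pd_zero, hu.bdryB x t ht]

end IsZKBSolution

/-- **Weighted L² identity** (identity (4.2) of the paper): for a classical
solution `u` with decay weight `b` of the ZKB problem on the strip `S` and each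
`t > 0`, `(d/dt)(e^{2bx},u²)(t) + (2+6b)(e^{2bx},u_x²)(t) + 2b(e^{2bx},u_y²)(t)
 − (4b/3)(e^{2bx},u³)(t) − (4b²+8b³)(e^{2bx},u²)(t) = 0`. -/
theorem zkb_weighted_L2_identity (B b : ℝ) (hB : 0 < B) (hb : 0 < b)
    (u : ℝ → ℝ → ℝ → ℝ) (hu : IsZKBSolution B b u) :
    ∀ t : ℝ, 0 < t →
      deriv (fun τ => ∫ p in strip B, Real.exp (2*b*p.1) * (u p.1 p.2 τ)^2) t
        + (2 + 6*b) * (∫ p in strip B, Real.exp (2*b*p.1) * (pd 1 0 0 u p.1 p.2 t)^2)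
        + 2*b * (∫ p in strip B, Real.exp (2*b*p.1) * (pd 0 1 0 u p.1 p.2 t)^2)
        - (4*b/3) * (∫ p in strip B, Real.exp (2*b*p.1) * (u p.1 p.2 t)^3)
        - (4*b^2 + 8*b^3) * (∫ p in strip B, Real.exp (2*b*p.1) * (u p.1 p.2 t)^2)
      = 0 := by
  intro t ht
  have I (i j : ℕ) (h : i + j + 0 ≤ 5) := hu.integrableOn_mul h h ht.le
  have I₀ := I 0 0 (by norm_num)
  have Ix := I 1 0 (by norm_num)
  have Iy := I 0 1 (by norm_num)
  have I₃ := hu.integrableOn_mul_mul (i := 0) (j := 0) (k := 0) (i' := 0) (j' := 0) (k' := 0)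
    (by norm_num) (by norm_num) ht.le
  have hX := integral_strip_deriv_fst (hu.hasDerivAt_fluxX t) (hu.integrableOn_fluxX ht.le)
    (hu.integrableOn_fluxXDeriv ht.le)
  have hY := hu.integral_fluxYDeriv hB.le ht.le
  have hbalance : ∫ p in strip B, 2 * (Real.exp (2 * b * p.1) *
      (pd 0 0 0 u p.1 p.2 t * pd 0 0 1 u p.1 p.2 t)) =
      ∫ p in strip B, (IsZKBSolution.fluxXDeriv b u t p + IsZKBSolution.fluxYDeriv b u t p
        - (2 + 6 * b) * (Real.exp (2 * b * p.1) *
          (pd 1 0 0 u p.1 p.2 t * pd 1 0 0 u p.1 p.2 t))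
        - 2 * b * (Real.exp (2 * b * p.1) * (pd 0 1 0 u p.1 p.2 t * pd 0 1 0 u p.1 p.2 t))
        + 4 * b / 3 * (pd 0 0 0 u p.1 p.2 t * (Real.exp (2 * b * p.1) *
          (pd 0 0 0 u p.1 p.2 t * pd 0 0 0 u p.1 p.2 t)))
        + (4 * b ^ 2 + 8 * b ^ 3) * (Real.exp (2 * b * p.1) *
          (pd 0 0 0 u p.1 p.2 t * pd 0 0 0 u p.1 p.2 t))) := by
    refine setIntegral_congr_fun measurableSet_strip fun p hp => ?_
    have h := hu.pde p.1 p.2 hp.2 t ht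
    rw [← pd_zero (u := u)] at h
    simp only [IsZKBSolution.fluxXDeriv, IsZKBSolution.fluxX, IsZKBSolution.fluxYDeriv]
    linear_combination 2 * Real.exp (2 * b * p.1) * pd 0 0 0 u p.1 p.2 t * h
  have hXY := (hu.integrableOn_fluxXDeriv ht.le).add (hu.integrableOn_fluxYDeriv ht.le)
  have hXYx := hXY.sub (Ix.const_mul (2 + 6 * b))
  have hXYxy := hXYx.sub (Iy.const_mul (2 * b))
  have hXYxy₃ := hXYxy.add (I₃.const_mul (4 * b / 3))
  rw [integral_add (by exact hXYxy₃) (I₀.const_mul _),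
    integral_add (by exact hXYxy) (I₃.const_mul _),
    integral_sub (by exact hXYx) (Iy.const_mul _), integral_sub (by exact hXY) (Ix.const_mul _),
    integral_add (hu.integrableOn_fluxXDeriv ht.le) (hu.integrableOn_fluxYDeriv ht.le), hX, hY]
    at hbalance
  rw [(hu.hasDerivAt_integral_sq ht).deriv, hbalance]
  simp only [integral_const_mul]
  have hcube : ∫ p in strip B, pd 0 0 0 u p.1 p.2 t * (Real.exp (2 * b * p.1) *
      (pd 0 0 0 u p.1 p.2 t * pd 0 0 0 u p.1 p.2 t)) =
      ∫ p in strip B, Real.exp (2 * b * p.1) * u p.1 p.2 t ^ 3 :=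
    integral_congr_ae (.of_forall fun p => by simp only [pd_zero]; ring)
  rw [hcube]
  simp only [pd_zero, ← sq]
  ring
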